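/- arXiv:2009.04024 — 8 statements merged into one kernel-verified Lean document; each statement's English description precedes it below -/
import Mathlib

section
/- Let K be a commutative ring, A a commutative K-algebra and P an A-module. Let Π : A → A → A be a K-bilinear alternating map which is a derivation in each argument (Π(a, bc) = b·Π(a,c) + c·Π(a,b) for all a,b,c ∈ A), and let ∇ : A → P → P be a K-bilinear map which is a derivation in the A-slot (∇(ab, p) = a•∇(b,p) + b•∇(a,p)) and satisfies the Der-Leibniz rule in the P-slot (∇(a, b•p) = Π(a,b)•p + b•∇(a,p)). Then the bracket B on A × P defined by B((a,p),(b,q)) := (Π(a,b), ∇(a,q) − ∇(b,p)) satisfies the cyclic Jacobi identity B(B(x,y),z) + B(B(y,z),x) + B(B(z,x),y) = 0 for all x,y,z ∈ A × P if and only if both of the following hold: (1) Π satisfies the Jacobi identity Π(Π(a,b),c) + Π(Π(b,c),a) + Π(Π(c,a),b) = 0 for all a,b,c ∈ A; and (2) the flatness equation ∇(a, ∇(b,p)) − ∇(b, ∇(a,p)) − ∇(Π(a,b), p) = 0 holds for all a,b ∈ A and p ∈ P. (This is the theorem characterizing degree-zero diolic Poisson structures: a degree-zero diolic biderivation Π₀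 = (Π, ∇) satisfies [[Π₀,Π₀]] = 0 if and only if Π is a Poisson structure on A and ∇ is a flat Hamiltonian connection.) -/
/-- Characterization of degree-zero diolic Poisson structures: a degree-zero diolic
biderivation `(Π, ∇)` on `𝒜 = A ⊕ P` (with `Π` a skew biderivation of `A` and `∇`
satisfying the Der-Leibniz rule over `Π`) yields a bracket
`B((a,p),(b,q)) = (Π(a,b), ∇(a,q) − ∇(b,p))` satisfying the cyclic Jacobi identity iff
`Π` satisfies the Jacobi identity and `∇` is flat:
`∇(a,∇(b,p)) − ∇(b,∇(a,p)) − ∇(Π(a,b),p) = 0`. -/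
theorem diolic_degree_zero_poisson_iff
    {K A P : Type*} [CommRing K] [CommRing A] [Algebra K A]
    [AddCommGroup P] [Module A P] [Module K P]
    (Pbr : A →ₗ[K] A →ₗ[K] A)
    (halt : ∀ a : A, Pbr a a = 0)
    (hder : ∀ a b c : A, Pbr a (b * c) = b * Pbr a c + c * Pbr a b)
    (N : A →ₗ[K] P →ₗ[K] P)
    (hNder : ∀ (a b : A) (p : P), N (a * b) p = a • N b p + b • N a p)
    (hNleib : ∀ (a b : A) (p : P), N a (b • p) = Pbr a b • p + b • N a p)
    (B : A × P → A × P → A × P)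
    (hB : ∀ x y : A × P, B x y = (Pbr x.1 y.1, N x.1 y.2 - N y.1 x.2)) :
    (∀ x y z : A × P, B (B x y) z + B (B y z) x + B (B z x) y = 0) ↔
      ((∀ a b c : A, Pbr (Pbr a b) c + Pbr (Pbr b c) a + Pbr (Pbr c a) b = 0) ∧
        ∀ (a b : A) (p : P), N a (N b p) - N b (N a p) - N (Pbr a b) p = 0) := by
  refine ⟨fun h => ⟨fun a b c => ?_, fun a b p => ?_⟩, ?_⟩
  · simpa [hB] using congrArg Prod.fst (h (a, 0) (b, 0) (c, 0))
  · have key := congrArg Prod.snd (h (a, 0) (b, 0) (0, p))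
    simp only [hB, Prod.snd_add, Prod.snd_zero, map_zero, map_neg, LinearMap.zero_apply,
      sub_zero, zero_sub] at key
    rw [← neg_eq_zero, ← key]
    abel
  · rintro ⟨hJ, hF⟩ ⟨a, p⟩ ⟨b, q⟩ ⟨c, r⟩
    refine Prod.ext (by simpa [hB] using hJ a b c) ?_
    have key : -(N a (N b r) - N b (N a r) - N (Pbr a b) r)
        - (N b (N c p) - N c (N b p) - N (Pbr b c) p)
        - (N c (N a q) - N a (N c q) - N (Pbr c a) q) = 0 := by
      rw [hF, hF, hF]
      simp
    simp only [hB, Prod.snd_add, Prod.snd_zero, map_sub]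
    rw [← key]
    abel
end

section
/- Let K be a commutative ring, A a commutative K-algebra and P an A-module. Let Π : A → A → A be a K-bilinear alternating map such that for each a ∈ A the map Π(a, −) : A → A is a first-order differential operator (δ_b ∘ δ_c (Π(a,−)) = 0 for all b, c ∈ A), and let ∇ : A → P → P be a K-bilinear map such that ∇(−, p) : A → P is a first-order differential operator for each p ∈ P and ∇(a, −) : P → P is a first-order differential operator for each a ∈ A. Then the bracket B on A × P defined by B((a,p),(b,q)) := (Π(a,b), ∇(a,q) − ∇(b,p)) satisfies the cyclic Jacobi identity B(B(x,y),z) + B(B(y,z),x) + B(B(z,x),y) = 0 for all x,y,z ∈ A × P if and only if both of the following hold: (1) Π satisfies the Jacobi identity Π(Π(a,b),c) + Π(Π(b,c),a) + Π(Π(c,a),b) = 0 for all a,b,c ∈ A; and (2) the diolic Jacobi equation ∇(Π(a,b), p) − ∇(a, ∇(b,p)) + ∇(b, ∇(a,p)) = 0 holds for all a,b ∈ A, p ∈ P. (This is the lemma characterizing degree-zero diolic Jacobi structures: the first-order bi-differential operator □₀ = (Π, ∇) is a diolic Jacobi structure if and only if the Jacobiators Jac(a,b,c) and Jac(a,b,p)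 vanish.) -/
/-- For a `K`-linear-type map `φ : M → N` between `R`-modules and `a : R`,
`dop a φ = a • φ − φ ∘ (a • −)` is the basic operation defining algebraic
differential operators: `φ` has order `≤ k` iff `k + 1` iterated `dop`'s kill it. -/
def dop {R M N : Type*} [CommRing R] [AddCommGroup M] [AddCommGroup N]
    [Module R M] [Module R N] (a : R) (φ : M → N) : M → N :=
  fun m => a • φ m - φ (a • m)

/-- Characterization of degree-zero diolic Jacobi structures: given skew first-order
bi-differential operators `Π : A × A → A` and `∇ : A × P → P`, the bracket
`B((a,p),(b,q)) = (Π(a,b), ∇(a,q) − ∇(b,p))` on `𝒜 = A ⊕ P` satisfies the cyclic Jacobi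
identity iff `Π` satisfies the Jacobi identity and the diolic Jacobi equation
`∇(Π(a,b),p) − ∇(a,∇(b,p)) + ∇(b,∇(a,p)) = 0` holds. -/
theorem diolic_degree_zero_jacobi_iff
    {K A P : Type*} [CommRing K] [CommRing A] [Algebra K A]
    [AddCommGroup P] [Module A P] [Module K P]
    (Pbr : A →ₗ[K] A →ₗ[K] A)
    (halt : ∀ a : A, Pbr a a = 0)
    (hPbrDO : ∀ a b c : A, dop b (dop c (fun x => Pbr a x)) = 0)
    (N : A →ₗ[K] P →ₗ[K] P)
    (hNDO1 : ∀ (p : P) (b c : A), dop b (dop c (fun a => N a p)) = 0)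
    (hNDO2 : ∀ (a : A) (b c : A), dop b (dop c (fun q => N a q)) = 0)
    (B : A × P → A × P → A × P)
    (hB : ∀ x y : A × P, B x y = (Pbr x.1 y.1, N x.1 y.2 - N y.1 x.2)) :
    (∀ x y z : A × P, B (B x y) z + B (B y z) x + B (B z x) y = 0) ↔
      ((∀ a b c : A, Pbr (Pbr a b) c + Pbr (Pbr b c) a + Pbr (Pbr c a) b = 0) ∧
        ∀ (a b : A) (p : P), N (Pbr a b) p - N a (N b p) + N b (N a p) = 0) := by
  constructor
  · intro h
    refine ⟨fun a b c => ?_, fun a b p => ?_⟩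
    · simpa [hB] using congrArg Prod.fst (h (a, 0) (b, 0) (c, 0))
    · have := congrArg Prod.snd (h (a, 0) (b, 0) (0, p))
      simp only [hB, Prod.snd_add, Prod.snd_zero, map_zero, LinearMap.zero_apply, sub_zero,
        zero_sub, map_neg, neg_neg] at this
      rw [← this]
      abel
  · rintro ⟨hA, hP⟩ ⟨a, p⟩ ⟨b, q⟩ ⟨c, r⟩
    simp only [hB]
    refine Prod.ext (hA a b c) ?_
    simp only [Prod.snd_add, Prod.snd_zero, map_sub]
    have h₃ := congrArg₂ (· + ·) (congrArg₂ (· + ·) (hP a b r) (hP b c p)) (hP c a q)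
    simp only [add_zero] at h₃
    rw [← h₃]
    abel
end

section
/- Let K be a commutative ring, A a commutative K-algebra and P a projective A-module. Then for every K-derivation X : A → A there exists a K-linear map ∇ : P → P such that ∇(a • p) = X(a) • p + a • ∇(p) for all a ∈ A and p ∈ P. (This is the surjectivity of the symbol map σ : Der(P) → D(A) in the diolic Atiyah sequence 0 → End_A(P) → D₀(𝒜) → D(A) → 0, which is short exact for projective P.) -/
/-- Surjectivity of the symbol map in the degree-zero diolic Atiyah sequence
`0 → End_A(P) → D₀(𝒜) → D(A) → 0` for projective `P`: every `K`-derivation `X` of `A`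
lifts to a Der-operator `∇ : P → P` over `X`, i.e. a `K`-linear map satisfying
`∇(a • p) = X(a) • p + a • ∇(p)` (a connection/covariant derivative along `X`). -/
theorem diolic_atiyah_symbol_surjective_of_projective
    {K A P : Type*} [CommRing K] [CommRing A] [Algebra K A]
    [AddCommGroup P] [Module A P] [Module K P] [IsScalarTower K A P]
    [Module.Projective A P]
    (X : Derivation K A A) :
    ∃ N : P →ₗ[K] P, ∀ (a : A) (p : P), N (a • p) = X a • p + a • N p := by
  obtain ⟨s, hs⟩ := Module.projective_def'.1 (inferInstance : Module.Projective A P)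
  let D : (P →₀ A) →ₗ[K] (P →₀ A) := Finsupp.mapRange.linearMap (X : A →ₗ[K] A)
  have hD (a : A) (f : P →₀ A) : D (a • f) = X a • f + a • D f := by
    ext i
    simp [D, mul_comm, add_comm]
  let π : (P →₀ A) →ₗ[A] P := Finsupp.linearCombination A id
  have hπ (p : P) : π (s p) = p := LinearMap.congr_fun hs p
  refine ⟨π.restrictScalars K ∘ₗ D ∘ₗ s.restrictScalars K, fun a p => ?_⟩
  simp [hD, hπ]
end

section
/- Let K be a commutative ring, A a commutative K-algebra and P an A-module. Let □_A : A → A and □_P : P → P be K-linear maps and let D be the K-linear endomorphism of the diolic algebra TrivSqZeroExt A P given by D(a,p) = (□_A a, □_P p). For x ∈ TrivSqZeroExt A P let δ_x(D) := L_x ∘ D − D ∘ L_x, where L_x is left multiplication by x. Then δ_{x₀} ∘ δ_{x₁} ∘ ⋯ ∘ δ_{x_k}(D) = 0 for all x₀, …, x_k ∈ TrivSqZeroExt A P if and only if all of the following hold: (1) □_A is a differential operator of order ≤ k on A; (2) □_P is a differential operator of order ≤ k on P; and (3) for all a₁, …, a_k ∈ A and p ∈ P, (δ_{a₁} ∘ ⋯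 ∘ δ_{a_k})(□_P)(p) = ((δ_{a₁} ∘ ⋯ ∘ δ_{a_k})(□_A)(1)) • p, i.e. □_A and □_P have the same scalar-type symbol. (This is the degree-zero part of the theorem characterizing diolic differential operators of order k.) -/
open TrivSqZeroExt

section dop

variable {R M N : Type*} [CommRing R] [AddCommGroup M] [AddCommGroup N] [Module R M] [Module R N]

theorem dop_add_fun (a : R) (φ ψ : M → N) : dop a (φ + ψ) = dop a φ + dop a ψ := by
  funext m
  simp only [dop, Pi.add_apply, smul_add]
  abel

theorem foldr_dop_add_fun (l : List R) (φ ψ : M → N) :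
    l.foldr dop (φ + ψ) = l.foldr dop φ + l.foldr dop ψ := by
  induction l with
  | nil => rfl
  | cons a l ih => simp only [List.foldr_cons, ih, dop_add_fun]

theorem foldr_dop_zero (l : List R) : l.foldr dop (0 : M → N) = 0 := by
  induction l with
  | nil => rfl
  | cons a l ih =>
    funext m
    simp [ih, dop]

theorem foldr_dop_map_add (l : List R) (φ : M → N) (h : ∀ x y, φ (x + y) = φ x + φ y) (x y : M) :
    l.foldr dop φ (x + y) = l.foldr dop φ x + l.foldr dop φ y := by
  induction l generalizing x y with
  | nil => exact h x y
  | cons a l ih =>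
    simp only [List.foldr_cons, dop, smul_add, ih]
    abel

/-- The defect of `R`-linearity between `F : R → R` and `G : M → M` along `q : M`. -/
def smulDefect (F : R → R) (G : M → M) (q : M) : R → M :=
  fun a => F a • q - G (a • q)

theorem dop_smulDefect (b : R) (F : R → R) (G : M → M) (q : M) :
    dop b (smulDefect F G q) = smulDefect (dop b F) (dop b G) q := by
  funext a
  simp only [dop, smulDefect, smul_sub, sub_smul, smul_assoc]
  abel

theorem foldr_dop_smulDefect (l : List R) (F : R → R) (G : M → M) (q : M) :
    l.foldr dop (smulDefect F G q) = smulDefect (l.foldr dop F) (l.foldr dop G) q := by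
  induction l with
  | nil => rfl
  | cons b l ih => simp only [List.foldr_cons, ih, dop_smulDefect]

end dop

section TrivSqZeroExt

variable {A P : Type*} [CommRing A] [AddCommGroup P] [Module A P] [Module Aᵐᵒᵖ P]
  [IsCentralScalar A P]

theorem dop_fst (y x : TrivSqZeroExt A P) (Φ : TrivSqZeroExt A P → TrivSqZeroExt A P) :
    (dop y Φ x).fst = y.fst * (Φ x).fst - (Φ (y * x)).fst := by
  simp [dop]

theorem dop_snd (y x : TrivSqZeroExt A P) (Φ : TrivSqZeroExt A P → TrivSqZeroExt A P) :
    (dop y Φ x).snd = y.fst • (Φ x).snd + (Φ x).fst • y.snd - (Φ (y * x)).snd := by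
  simp [dop]

variable {D : TrivSqZeroExt A P → TrivSqZeroExt A P} {F : A → A} {G : P → P}

theorem foldr_dop_fst (hfst : ∀ x, (D x).fst = F x.fst) (l : List (TrivSqZeroExt A P))
    (x : TrivSqZeroExt A P) :
    (l.foldr dop D x).fst = (l.map fst).foldr dop F x.fst := by
  induction l generalizing x with
  | nil => exact hfst x
  | cons y l ih =>
    rw [List.foldr_cons, dop_fst, ih, ih]
    simp [dop]

theorem foldr_dop_map_inl_snd (hsnd : ∀ x, (D x).snd = G x.snd)
    (l : List A) (x : TrivSqZeroExt A P) :
    ((l.map (inl : A → TrivSqZeroExt A P)).foldr dop D x).snd = l.foldr dop G x.snd := by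
  induction l generalizing x with
  | nil => exact hsnd x
  | cons y l ih =>
    rw [List.map_cons, List.foldr_cons, dop_snd, ih, ih]
    simp [dop]

/-- The off-diagonal part of an iterated commutator of a diagonal map is annihilated by
commutators as soon as all defects of `A`-linearity of order `k` vanish. -/
theorem exists_foldr_dop_snd (hsnd : ∀ x, (D x).snd = G x.snd)
    (hG : ∀ x y, G (x + y) = G x + G y) (hfst : ∀ x, (D x).fst = F x.fst) {k : ℕ}
    (hdefect : ∀ l : List A, l.length = k → ∀ q : P,
      smulDefect (l.foldr dop F) (l.foldr dop G) q = 0)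
    (l : List (TrivSqZeroExt A P)) :
    ∃ H : A → P,
      (∀ x, (l.foldr dop D x).snd = (l.map fst).foldr dop G x.snd + H x.fst) ∧
      ∀ m : List A, m.length + l.length = k + 1 → m.foldr dop H = 0 := by
  induction l with
  | nil => exact ⟨0, fun x => by simp [hsnd], fun m _ => foldr_dop_zero m⟩
  | cons y l ih =>
    obtain ⟨H, hH, hm⟩ := ih
    refine ⟨dop y.fst H + smulDefect ((l.map fst).foldr dop F) ((l.map fst).foldr dop G) y.snd,
      fun x => ?_, fun m hlen => ?_⟩
    · rw [List.foldr_cons, dop_snd, hH, hH, foldr_dop_fst hfst]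
      simp only [List.map_cons, List.foldr_cons, dop, smulDefect, Pi.add_apply, fst_mul, snd_mul,
        op_smul_eq_smul, foldr_dop_map_add _ G hG, smul_add, smul_eq_mul]
      abel
    · rw [List.length_cons] at hlen
      have h₁ := hm (m ++ [y.fst]) (by simp; omega)
      have h₂ := hdefect (m ++ l.map fst) (by simp; omega) y.snd
      rw [List.foldr_append, List.foldr_append] at h₂
      rw [List.foldr_append, List.foldr_cons, List.foldr_nil] at h₁
      rw [foldr_dop_add_fun, h₁, foldr_dop_smulDefect, h₂, add_zero]

end TrivSqZeroExt

/-- Degree-zero diolic differential operators of order `≤ k`: the endomorphism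
`D(a,p) = (□_A a, □_P p)` of the diolic algebra `𝒜 = A ⊕ P` is a differential operator
of order `≤ k` (i.e. all `k+1`-fold commutators with multiplications vanish) iff `□_A`
and `□_P` are differential operators of order `≤ k` having the same scalar-type symbol:
`(δ_{a₁}∘⋯∘δ_{a_k})(□_P)(p) = ((δ_{a₁}∘⋯∘δ_{a_k})(□_A)(1)) • p`. -/
theorem diolic_diff_op_degree_zero
    {K A P : Type*} [CommRing K] [CommRing A] [Algebra K A]
    [AddCommGroup P] [Module A P] [Module Aᵐᵒᵖ P] [IsCentralScalar A P] [Module K P]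
    (k : ℕ) (boxA : A →ₗ[K] A) (boxP : P →ₗ[K] P)
    (D : TrivSqZeroExt A P →ₗ[K] TrivSqZeroExt A P)
    (hfst : ∀ x : TrivSqZeroExt A P, (D x).fst = boxA x.fst)
    (hsnd : ∀ x : TrivSqZeroExt A P, (D x).snd = boxP x.snd) :
    (∀ l : List (TrivSqZeroExt A P), l.length = k + 1 → l.foldr dop ⇑D = 0) ↔
      ((∀ l : List A, l.length = k + 1 → l.foldr dop ⇑boxA = 0) ∧
       (∀ l : List A, l.length = k + 1 → l.foldr dop ⇑boxP = 0) ∧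
       (∀ l : List A, l.length = k →
          ∀ p : P, l.foldr dop ⇑boxP p = (l.foldr dop ⇑boxA 1) • p)) := by
  have hG := map_add boxP
  constructor
  · intro h
    refine ⟨fun l hl => ?_, fun l hl => ?_, fun l hl p => ?_⟩
    · funext a
      have := foldr_dop_fst hfst (l.map inl) (inl a)
      rw [h _ (by simpa using hl)] at this
      simpa [Function.comp_def] using this.symm
    · funext p
      have := foldr_dop_map_inl_snd hsnd l (inr p)
      rw [h _ (by simpa using hl)] at this
      simpa using this.symm
    · have := congrArg snd (congrFun (h (inr p :: l.map inl) (by simpa using hl)) 1)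
      rw [List.foldr_cons, dop_snd, foldr_dop_fst hfst, foldr_dop_map_inl_snd hsnd,
        foldr_dop_map_inl_snd hsnd] at this
      simp only [List.map_map, Function.comp_def, fst_inl, List.map_id', mul_one, fst_inr, snd_inr,
        zero_smul, zero_add, fst_one, Pi.zero_apply, snd_zero] at this
      exact (sub_eq_zero.mp this).symm
  · rintro ⟨hA, hP, hsymb⟩ l hl
    have hdefect : ∀ l : List A, l.length = k → ∀ q : P,
        smulDefect (l.foldr dop boxA) (l.foldr dop boxP) q = 0 := by
      intro l hl q
      funext a
      have h₁ := congrFun (hA (a :: l) (by simpa using hl)) 1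
      have h₂ := congrFun (hP (a :: l) (by simpa using hl)) q
      simp only [List.foldr_cons, dop, smul_eq_mul, mul_one, Pi.zero_apply, sub_eq_zero] at h₁ h₂
      simp only [smulDefect, Pi.zero_apply]
      rw [← h₁, ← h₂, hsymb l hl, mul_smul, sub_self]
    obtain ⟨H, hH, hm⟩ := exists_foldr_dop_snd hsnd hG hfst hdefect l
    have hH₀ : H = 0 := hm [] (by simpa using hl)
    funext x
    refine TrivSqZeroExt.ext ?_ ?_
    · rw [foldr_dop_fst hfst, hA _ (by simpa using hl)]
      rfl
    · rw [hH, hP _ (by simpa using hl), hH₀]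
      simp
end

section
/- Let K be a commutative ring, A a commutative K-algebra and P an A-module. Let Θ : A → P be a K-linear map and let D be the K-linear endomorphism of the diolic algebra TrivSqZeroExt A P given by D(a,p) = (0, Θ a). For x ∈ TrivSqZeroExt A P let δ_x(D) := L_x ∘ D − D ∘ L_x, where L_x is left multiplication by x. Then δ_{x₀} ∘ δ_{x₁} ∘ ⋯ ∘ δ_{x_k}(D) = 0 for all x₀, …, x_k ∈ TrivSqZeroExt A P if and only if Θ is a differential operator of order ≤ k from A to P. (This is the degree-one part of the theorem on diolic differential operators: Diff_k(𝒜)₁ is isomorphic as an A-module to the P-valued differential operators Diff_k(A, P).) -/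
open TrivSqZeroExt

/-- An iterated commutator of `x ↦ (0, θ x.fst)` depends only on the first components of the
multipliers, and is obtained from the iterated commutator of `θ` in the same way. -/
theorem foldr_dop_eq_inr {A P : Type*} [CommRing A] [AddCommGroup P] [Module A P]
    [Module Aᵐᵒᵖ P] [IsCentralScalar A P] {θ : A → P}
    {f : TrivSqZeroExt A P → TrivSqZeroExt A P} (hf : ∀ x, f x = inr (θ x.fst))
    (l : List (TrivSqZeroExt A P)) (x : TrivSqZeroExt A P) :
    l.foldr dop f x = inr ((l.map fst).foldr dop θ x.fst) := by
  induction l generalizing x with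
  | nil => exact hf x
  | cons a l ih =>
    simp only [List.foldr_cons, List.map_cons, dop, ih]
    ext <;> simp

/-- Degree-one diolic differential operators of order `≤ k` are exactly the `P`-valued
differential operators of order `≤ k` on `A`: the endomorphism `D(a,p) = (0, Θ a)` of the
diolic algebra `𝒜 = A ⊕ P` is a differential operator of order `≤ k` iff
`Θ : A → P` is a differential operator of order `≤ k`. -/
theorem diolic_diff_op_degree_one
    {K A P : Type*} [CommRing K] [CommRing A] [Algebra K A]
    [AddCommGroup P] [Module A P] [Module Aᵐᵒᵖ P] [IsCentralScalar A P] [Module K P]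
    (k : ℕ) (Θ : A →ₗ[K] P)
    (D : TrivSqZeroExt A P →ₗ[K] TrivSqZeroExt A P)
    (hfst : ∀ x : TrivSqZeroExt A P, (D x).fst = 0)
    (hsnd : ∀ x : TrivSqZeroExt A P, (D x).snd = Θ x.fst) :
    (∀ l : List (TrivSqZeroExt A P), l.length = k + 1 → l.foldr dop ⇑D = 0) ↔
      (∀ l : List A, l.length = k + 1 → l.foldr dop ⇑Θ = 0) := by
  have hD (x : TrivSqZeroExt A P) : D x = inr (Θ x.fst) :=
    TrivSqZeroExt.ext (hfst x) (hsnd x)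
  constructor
  · intro h l hl
    funext a
    have hla := congrFun (h (l.map inl) (by simpa using hl)) (inl a)
    rw [foldr_dop_eq_inr hD] at hla
    simpa [Function.comp_def] using congrArg snd hla
  · intro h l hl
    funext x
    rw [foldr_dop_eq_inr hD, h (l.map fst) (by simpa using hl)]
    simp
end

section
/- Let K be a commutative ring, A a commutative K-algebra and P a projective A-module, and let k ≥ 1. Then for every K-linear differential operator □_A : A → A of order ≤ k there exists a K-linear differential operator □_P : P → P of order ≤ k such that for all a₁, …, a_k ∈ A and p ∈ P, (δ_{a₁} ∘ ⋯ ∘ δ_{a_k})(□_P)(p) = ((δ_{a₁} ∘ ⋯ ∘ δ_{a_k})(□_A)(1)) • p. (This is the surjectivity of the projection ς : Diff_k(𝒜)₀ → Diff_k(A) in the order-k diolic Atiyah sequence 0 → Diff_{k−1}(P,P) → Diff_k(𝒜)₀ → Diff_k(A) → 0, which is short exact when P is projective.) -/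
/-- `dop a` as an operation on `K`-linear endomorphisms of `A`. -/
def dopLinear {K A : Type*} [CommRing K] [CommRing A] [Algebra K A]
    (a : A) (D : A →ₗ[K] A) : A →ₗ[K] A :=
  a • D - D ∘ₗ LinearMap.mulLeft K a

theorem coe_dopLinear {K A : Type*} [CommRing K] [CommRing A] [Algebra K A]
    (a : A) (D : A →ₗ[K] A) : ⇑(dopLinear a D) = dop a ⇑D := by
  ext x
  simp [dopLinear, dop]

theorem coe_foldr_dopLinear {K A : Type*} [CommRing K] [CommRing A] [Algebra K A]
    (l : List A) (D : A →ₗ[K] A) : ⇑(l.foldr dopLinear D) = l.foldr dop ⇑D := by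
  induction l with
  | nil => rfl
  | cons a l ih => rw [List.foldr_cons, List.foldr_cons, coe_dopLinear, ih]

/-- Apply `D` to the coordinates, with respect to the generating family of all elements of `P`,
provided by `s`. -/
noncomputable def coordLift {K A P : Type*} [CommRing K] [CommRing A] [Algebra K A]
    [AddCommGroup P] [Module A P] [Module K P] [IsScalarTower K A P]
    (s : P →ₗ[A] (P →₀ A)) (D : A →ₗ[K] A) : P →ₗ[K] P :=
  (Finsupp.linearCombination A (id : P → P)).restrictScalars K ∘ₗ
    Finsupp.mapRange.linearMap D ∘ₗ s.restrictScalars K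

section coordLift

variable {K A P : Type*} [CommRing K] [CommRing A] [Algebra K A]
  [AddCommGroup P] [Module A P] [Module K P] [IsScalarTower K A P]
  (s : P →ₗ[A] (P →₀ A))

theorem coordLift_apply (D : A →ₗ[K] A) (p : P) :
    coordLift s D p =
      Finsupp.linearCombination A (id : P → P) (Finsupp.mapRange D (map_zero D) (s p)) :=
  rfl

theorem coordLift_dopLinear (a : A) (D : A →ₗ[K] A) :
    ⇑(coordLift s (dopLinear a D)) = dop a ⇑(coordLift s D) := by
  ext p
  simp only [dop, coordLift_apply]
  rw [← map_smul, ← map_sub]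
  congr 1
  ext q
  simp [dopLinear]

theorem coordLift_foldr_dopLinear (l : List A) (D : A →ₗ[K] A) :
    ⇑(coordLift s (l.foldr dopLinear D)) = l.foldr dop ⇑(coordLift s D) := by
  induction l with
  | nil => rfl
  | cons a l ih => rw [List.foldr_cons, List.foldr_cons, coordLift_dopLinear, ih]

theorem coordLift_apply_of_dop_eq_zero
    (hs : Function.LeftInverse (Finsupp.linearCombination A (id : P → P)) s)
    (D : A →ₗ[K] A) (hD : ∀ a : A, dop a ⇑D = 0) (p : P) :
    coordLift s D p = D 1 • p := by
  have hmul (a : A) : D a = D 1 * a := by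
    have h := congrFun (hD a) 1
    simp only [dop, smul_eq_mul, mul_one, Pi.zero_apply] at h
    rw [← sub_eq_zero.mp h, mul_comm]
  have hmap : Finsupp.mapRange D (map_zero D) (s p) = D 1 • s p := by
    ext q
    simp [hmul (s p q)]
  rw [coordLift_apply, hmap, map_smul, hs p]

end coordLift

/-- Surjectivity of the projection `ς : Diff_k(𝒜)₀ → Diff_k(A)` in the order-`k` diolic
Atiyah sequence `0 → Diff_{k−1}(P,P) → Diff_k(𝒜)₀ → Diff_k(A) → 0` for projective `P`:
every differential operator `□_A : A → A` of order `≤ k` lifts to a differential operator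
`□_P : P → P` of order `≤ k` with the same scalar-type symbol, i.e.
`(δ_{a₁}∘⋯∘δ_{a_k})(□_P)(p) = ((δ_{a₁}∘⋯∘δ_{a_k})(□_A)(1)) • p`. -/
theorem diolic_atiyah_order_k_surjective_of_projective
    {K A P : Type*} [CommRing K] [CommRing A] [Algebra K A]
    [AddCommGroup P] [Module A P] [Module K P] [IsScalarTower K A P]
    [Module.Projective A P]
    (k : ℕ) (hk : 1 ≤ k)
    (boxA : A →ₗ[K] A)
    (hA : ∀ l : List A, l.length = k + 1 → l.foldr dop ⇑boxA = 0) :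
    ∃ boxP : P →ₗ[K] P,
      (∀ l : List A, l.length = k + 1 → l.foldr dop ⇑boxP = 0) ∧
      (∀ l : List A, l.length = k →
        ∀ p : P, l.foldr dop ⇑boxP p = (l.foldr dop ⇑boxA 1) • p) := by
  obtain ⟨s, hs⟩ := Module.projective_def.mp (inferInstance : Module.Projective A P)
  refine ⟨coordLift s boxA, fun l hl => ?_, fun l hl p => ?_⟩
  · have h : l.foldr dopLinear boxA = 0 :=
      DFunLike.coe_injective ((coe_foldr_dopLinear l boxA).trans (hA l hl))
    rw [← coordLift_foldr_dopLinear, h]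
    ext p
    have h0 : Finsupp.mapRange (0 : A →ₗ[K] A) (map_zero _) (s p) = 0 := by
      ext q
      simp
    rw [coordLift_apply, h0, map_zero, Pi.zero_apply]
  · rw [← coordLift_foldr_dopLinear, ← coe_foldr_dopLinear]
    refine coordLift_apply_of_dop_eq_zero s hs _ (fun a => ?_) p
    rw [coe_foldr_dopLinear]
    exact hA (a :: l) (by simp [hl])
end

section
/- Let K be a commutative ring, A a commutative K-algebra and P a faithful A-module, and let k ≥ 1. Let (□_A, □_P) be a degree-zero diolic differential operator of order ≤ k, i.e. □_A : A → A and □_P : P → P are K-linear differential operators of order ≤ k satisfying (δ_{a₁}∘⋯∘δ_{a_k})(□_P)(p) = ((δ_{a₁}∘⋯∘δ_{a_k})(□_A)(1))•p for all a₁,…,a_k ∈ A, p ∈ P. Suppose in addition that for all a₁, …, a_{k−1} ∈ A, b ∈ A and p ∈ P one has (δ_{a₁}∘⋯∘δ_{a_{k−1}})(□_P)(b•p) = (((δ_{a₁}∘⋯∘δ_{a_{k−1}})(□_A))(b)) • p, i.e. (δ_{a₁}∘⋯∘δ_{a_{k−1}})(□_P) is the multiplication operator by the scalar operator (δ_{a₁}∘⋯∘δ_{a_{k−1}})(□_A).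 Then □_P is a differential operator of order ≤ k−1 and □_A is a differential operator of order ≤ k−1, so the pair (□_A, □_P) lies in Diff_{k−1}(𝒜)₀. (This is the kernel computation ker(λ^k) ≅ Diff_{k−1}(𝒜)₀ in the theorem characterizing degree-zero diolic symbols.) -/
/-- Kernel computation `ker(λ^k) ≅ Diff_{k−1}(𝒜)₀` in the characterization of degree-zero
diolic symbols: if `P` is a faithful `A`-module and `(□_A, □_P)` is a degree-zero diolic
differential operator of order `≤ k` such that every `(k−1)`-fold iterated commutator
`(δ_{a₁}∘⋯∘δ_{a_{k−1}})(□_P)` is the multiplication operator by the scalar operator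
`(δ_{a₁}∘⋯∘δ_{a_{k−1}})(□_A)`, then both `□_P` and `□_A` are differential operators of
order `≤ k − 1`, i.e. the pair lies in `Diff_{k−1}(𝒜)₀`. -/
theorem diolic_symbol_kernel
    {K A P : Type*} [CommRing K] [CommRing A] [Algebra K A]
    [AddCommGroup P] [Module A P] [Module K P]
    (hfaith : ∀ a : A, (∀ p : P, a • p = 0) → a = 0)
    (k : ℕ) (hk : 1 ≤ k)
    (boxA : A →ₗ[K] A) (boxP : P →ₗ[K] P)
    (hA : ∀ l : List A, l.length = k + 1 → l.foldr dop ⇑boxA = 0)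
    (hP : ∀ l : List A, l.length = k + 1 → l.foldr dop ⇑boxP = 0)
    (hsym : ∀ l : List A, l.length = k →
      ∀ p : P, l.foldr dop ⇑boxP p = (l.foldr dop ⇑boxA 1) • p)
    (hker : ∀ l : List A, l.length = k - 1 →
      ∀ (b : A) (p : P), l.foldr dop ⇑boxP (b • p) = (l.foldr dop ⇑boxA b) • p) :
    (∀ l : List A, l.length = k → l.foldr dop ⇑boxP = 0) ∧
    (∀ l : List A, l.length = k → l.foldr dop ⇑boxA = 0) := by
  obtain ⟨n, rfl⟩ : ∃ n, k = n + 1 := ⟨k - 1, by omega⟩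
  have hψ : ∀ l : List A, l.length = n → ∀ p : P,
      l.foldr dop ⇑boxP p = (l.foldr dop ⇑boxA 1) • p := fun l hl p => by
    simpa using hker l (by simpa using hl) 1 p
  have hφ : ∀ l : List A, l.length = n → ∀ b : A,
      l.foldr dop ⇑boxA b = (l.foldr dop ⇑boxA 1) * b := fun l hl b => by
    refine sub_eq_zero.mp (hfaith _ fun p => ?_)
    rw [sub_smul, ← hker l (by simpa using hl) b p, hψ l hl, mul_smul, sub_self]
  constructor
  · rintro (_ | ⟨a, l⟩) hl
    · simp at hl
    · have hl' : l.length = n := by simpa using hl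
      funext p
      simp only [List.foldr_cons, dop, Pi.zero_apply]
      rw [hψ l hl' p, hψ l hl' (a • p), smul_comm, sub_self]
  · rintro (_ | ⟨a, l⟩) hl
    · simp at hl
    · have hl' : l.length = n := by simpa using hl
      funext b
      simp only [List.foldr_cons, dop, Pi.zero_apply, smul_eq_mul]
      rw [hφ l hl' b, hφ l hl' (a * b), mul_left_comm, sub_self]
end

section
/- Let K be a commutative ring, A a commutative K-algebra, P an A-module, and let R₀, R₁ be A-modules equipped with an A-bilinear structure map φ : P × R₀ → R₁. Equip M = R₀ × R₁ with the action of the diolic algebra TrivSqZeroExt A P given by (a,p) • (r₀,r₁) := (a•r₀, a•r₁ + φ(p, r₀)). Let X : A → R₀ and Y : P → R₁ be K-linear maps and define D : TrivSqZeroExt A P → M by D(a,p) = (X a, Y p). Then D satisfies the Leibniz rule D(x · y) = x • D(y) + y • D(x) for all x, y ∈ TrivSqZeroExt A P if and only if X is a derivation of A with values in R₀ (X(ab) = a•X(b) + b•X(a) for all a,b ∈ A) and Y satisfies the φ-Der-Leibniz rule Y(a • p) = φ(p, X(a)) + a • Y(p) for all a ∈ A, p ∈ P. (This is the degree-zero part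 of the lemma characterizing graded derivations of a diolic algebra with values in a truncated diolic module (R₀ ⊕ R₁, φ): they are exactly the generalized φ-Der-operators.) -/
open TrivSqZeroExt

/-- Degree-zero derivations of the diolic algebra `𝒜 = A ⊕ P` with values in a truncated
diolic module `(R₀ ⊕ R₁, φ)` are exactly the generalized `φ`-Der-operators: the map
`D(a,p) = (X a, Y p)` satisfies the Leibniz rule with respect to the diolic action
`(a,p) • (r₀,r₁) = (a • r₀, a • r₁ + φ(p, r₀))` iff `X` is an `R₀`-valued derivation of
`A` and `Y` satisfies the `φ`-Der-Leibniz rule `Y(a • p) = φ(p, X a) + a • Y p`. -/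
theorem diolic_derivation_into_truncated_module_degree_zero
    {K A P R₀ R₁ : Type*} [CommRing K] [CommRing A] [Algebra K A]
    [AddCommGroup P] [Module A P] [Module Aᵐᵒᵖ P] [IsCentralScalar A P] [Module K P]
    [AddCommGroup R₀] [Module A R₀] [Module K R₀]
    [AddCommGroup R₁] [Module A R₁] [Module K R₁]
    (φ : P →ₗ[A] R₀ →ₗ[A] R₁)
    (act : TrivSqZeroExt A P → R₀ × R₁ → R₀ × R₁)
    (hact : ∀ (x : TrivSqZeroExt A P) (r : R₀ × R₁),
      act x r = (x.fst • r.1, x.fst • r.2 + φ x.snd r.1))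
    (X : A →ₗ[K] R₀) (Y : P →ₗ[K] R₁)
    (D : TrivSqZeroExt A P → R₀ × R₁)
    (hD : ∀ x : TrivSqZeroExt A P, D x = (X x.fst, Y x.snd)) :
    (∀ x y : TrivSqZeroExt A P, D (x * y) = act x (D y) + act y (D x)) ↔
      ((∀ a b : A, X (a * b) = a • X b + b • X a) ∧
        ∀ (a : A) (p : P), Y (a • p) = φ p (X a) + a • Y p) := by
  simp only [hD, hact, Prod.ext_iff, Prod.fst_add, Prod.snd_add, fst_mul, snd_mul,
    op_smul_eq_smul, map_add]
  constructor
  · refine fun h => ⟨fun a b => by simpa using (h (inl a) (inl b)).1, fun a p => ?_⟩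
    simpa [add_comm] using (h (inl a) (inr p)).2
  · rintro ⟨hX, hY⟩ x y
    refine ⟨hX _ _, ?_⟩
    rw [hY, hY]
    abel
end
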